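/- arXiv:2001.06082 — 3 statements merged into one kernel-verified Lean document; each statement's English description precedes it below -/
import Mathlib

section
/- Let N ≥ 1, let θ > 0 be fixed, and let h_θ : (0,∞)^N → ℝ be a C² strictly convex function satisfying Hypothesis (H6a). Then for every μ ∈ ℝ^N the supremum defining the convex conjugate h*_θ(μ) = sup_{ρ∈(0,∞)^N}(μ·ρ − h_θ(ρ)) is finite, nonnegative, and attained at a unique point ρ ∈ (0,∞)^N, which is characterized by the equation μ = ∇h_θ(ρ). Consequently the gradient map ∇h_θ : (0,∞)^N → ℝ^N is a bijection, h*_θ is differentiable on all of ℝ^N, and ∇h*_θ = (∇h_θ)^{-1} maps ℝ^N onto (0,∞)^N. -/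
open Filter Topology MeasureTheory Matrix

noncomputable section

/-- The positive orthant `(0,∞)^N`. -/
def posOrth (N : ℕ) : Set (Fin N → ℝ) := {ρ | ∀ i, 0 < ρ i}

/-- Total density `ρ̄ = ∑ᵢ ρᵢ`. -/
def rbar {N : ℕ} (ρ : Fin N → ℝ) : ℝ := ∑ i, ρ i

/-- Gradient: the vector of partial derivatives. -/
def pgrad {N : ℕ} (h : (Fin N → ℝ) → ℝ) (ρ : Fin N → ℝ) : Fin N → ℝ :=
  fun i => fderiv ℝ h ρ (Pi.single i 1)

/-- Hessian matrix of second partial derivatives. -/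
def phess {N : ℕ} (h : (Fin N → ℝ) → ℝ) (ρ : Fin N → ℝ) : Matrix (Fin N) (Fin N) ℝ :=
  Matrix.of fun i j => fderiv ℝ (fun x => pgrad h x j) ρ (Pi.single i 1)

/-- Hypothesis (H6a): `h(ρ) → 0` and `∇h(ρ)·ρ → 0` as `ρ̄ → 0⁺`, `h(ρ)/ρ̄ → ∞` as
`ρ̄ → ∞`, and for each `i` and `R > 0`, `sup_{ρⱼ ∈ (0,R), j ≠ i} ∂h/∂ρᵢ(ρ) → -∞`
as `ρᵢ → 0⁺`. -/
def H6a {N : ℕ} (h : (Fin N → ℝ) → ℝ) : Prop :=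
  Tendsto h (𝓟 (posOrth N) ⊓ Filter.comap (rbar (N := N)) (𝓝[>] (0:ℝ))) (𝓝 0) ∧
  Tendsto (fun ρ : Fin N → ℝ => ∑ i, pgrad h ρ i * ρ i)
      (𝓟 (posOrth N) ⊓ Filter.comap (rbar (N := N)) (𝓝[>] (0:ℝ))) (𝓝 0) ∧
  Tendsto (fun ρ : Fin N → ℝ => h ρ / rbar ρ)
      (𝓟 (posOrth N) ⊓ Filter.comap (rbar (N := N)) atTop) atTop ∧
  ∀ i : Fin N, ∀ R > (0:ℝ), ∀ M : ℝ, ∃ ε > (0:ℝ), ∀ ρ ∈ posOrth N,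
    ρ i < ε → (∀ j, j ≠ i → ρ j < R) → pgrad h ρ i < M

/-- The convex conjugate (Legendre transform) `h*(μ) = sup_{ρ ∈ (0,∞)^N} (μ·ρ - h(ρ))`. -/
def hstar {N : ℕ} (h : (Fin N → ℝ) → ℝ) (μ : Fin N → ℝ) : ℝ :=
  sSup ((fun ρ => (∑ i, μ i * ρ i) - h ρ) '' posOrth N)

/-- The uniform convexity bound (LMB21): `∇²h(ρ)x·x ≥ (Kθ/ρ̄)|x|²`. -/
def LMB21 {N : ℕ} (h : (Fin N → ℝ) → ℝ) (θ K : ℝ) : Prop :=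
  ∀ ρ ∈ posOrth N, ∀ x : Fin N → ℝ,
    K * θ / rbar ρ * (∑ i, x i ^ 2) ≤ ∑ i, ∑ j, phess h ρ i j * x i * x j

theorem isOpen_posOrth (N : ℕ) : IsOpen (posOrth N) := by
  have : posOrth N = ⋂ i, {ρ : Fin N → ℝ | 0 < ρ i} := by ext; simp [posOrth]
  rw [this]
  exact isOpen_iInter_of_finite fun i => isOpen_lt continuous_const (continuous_apply i)

/-- A derivative is recovered from the vector of partial derivatives. -/
theorem fderiv_apply_eq_sum_pgrad {N : ℕ} (h : (Fin N → ℝ) → ℝ) (ρ v : Fin N → ℝ) :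
    fderiv ℝ h ρ v = ∑ i, pgrad h ρ i * v i := by
  conv_lhs => rw [pi_eq_sum_univ' v]
  simp [pgrad, map_sum, mul_comm]

/-- The linear functional `x ↦ μ · x`. -/
def dotCLM {N : ℕ} (μ : Fin N → ℝ) : (Fin N → ℝ) →L[ℝ] ℝ :=
  ∑ i, μ i • ContinuousLinearMap.proj i

theorem dotCLM_apply {N : ℕ} (μ x : Fin N → ℝ) : dotCLM μ x = ∑ i, μ i * x i := by
  simp [dotCLM]

theorem pgrad_eq_of_hasFDerivAt {N : ℕ} {h : (Fin N → ℝ) → ℝ} {ρ μ : Fin N → ℝ}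
    (hd : HasFDerivAt h (dotCLM μ) ρ) : pgrad h ρ = μ := by
  ext i
  simp [pgrad, hd.fderiv, dotCLM_apply, Pi.single_apply]

theorem abs_sum_mul_le {N : ℕ} (a b : Fin N → ℝ) : |∑ i, a i * b i| ≤ N * (‖a‖ * ‖b‖) := by
  calc |∑ i, a i * b i| ≤ ∑ i, |a i * b i| := Finset.abs_sum_le_sum_abs _ _
    _ ≤ ∑ _i : Fin N, ‖a‖ * ‖b‖ := by
        refine Finset.sum_le_sum fun i _ => ?_
        rw [abs_mul]
        exact mul_le_mul (norm_le_pi_norm a i) (norm_le_pi_norm b i) (abs_nonneg _)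
          (norm_nonneg _)
    _ = N * (‖a‖ * ‖b‖) := by simp

/-- A convex function lies above its tangent planes. -/
theorem ConvexOn.add_fderiv_le {E : Type*} [NormedAddCommGroup E] [NormedSpace ℝ E]
    {s : Set E} {h : E → ℝ} (hc : ConvexOn ℝ s h) {x y : E} (hx : x ∈ s) (hy : y ∈ s)
    (hd : DifferentiableAt ℝ h x) : h x + fderiv ℝ h x (y - x) ≤ h y := by
  have hline : HasDerivAt (fun t : ℝ => h (x + t • (y - x))) (fderiv ℝ h x (y - x)) 0 := by
    have h1 : HasDerivAt (fun t : ℝ => x + t • (y - x)) (y - x) 0 := by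
      simpa using ((hasDerivAt_id (0 : ℝ)).smul_const (y - x)).const_add x
    have h2 : HasFDerivAt h (fderiv ℝ h x) (x + (0 : ℝ) • (y - x)) := by
      simpa using hd.hasFDerivAt
    exact h2.comp_hasDerivAt 0 h1
  have hlim := hline.tendsto_slope_zero_right
  have : fderiv ℝ h x (y - x) ≤ h y - h x := by
    refine le_of_tendsto hlim ?_
    filter_upwards [Ioo_mem_nhdsGT (zero_lt_one' ℝ)] with t ht
    have hcv := hc.2 hx hy (sub_nonneg.2 ht.2.le) ht.1.le (by ring)
    have he : (1 - t) • x + t • y = x + t • (y - x) := by module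
    rw [he] at hcv
    simp only [smul_eq_mul, zero_add, zero_smul, add_zero] at hcv ⊢
    rw [inv_mul_le_iff₀ ht.1]
    linarith
  linarith

/-- A strictly convex function lies strictly above its tangent planes off the contact point. -/
theorem StrictConvexOn.add_fderiv_lt {E : Type*} [NormedAddCommGroup E] [NormedSpace ℝ E]
    {s : Set E} {h : E → ℝ} (hc : StrictConvexOn ℝ s h) {x y : E} (hx : x ∈ s) (hy : y ∈ s)
    (hxy : x ≠ y) (hd : DifferentiableAt ℝ h x) : h x + fderiv ℝ h x (y - x) < h y := by
  have h2 : (0 : ℝ) < 1 / 2 := by norm_num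
  have hs : (1 / 2 : ℝ) + 1 / 2 = 1 := by norm_num
  have hm := hc.2 hx hy hxy h2 h2 hs
  have hle := hc.convexOn.add_fderiv_le hx (hc.1 hx hy h2.le h2.le hs) hd
  have he : ((1 / 2 : ℝ) • x + (1 / 2 : ℝ) • y) - x = (1 / 2 : ℝ) • (y - x) := by module
  rw [he, map_smul] at hle
  simp only [smul_eq_mul] at hm hle
  linarith

section Conjugate

variable {N : ℕ} {h : (Fin N → ℝ) → ℝ}

theorem lt_of_pgrad_eq (hSC : StrictConvexOn ℝ (posOrth N) h) {ρ σ μ : Fin N → ℝ}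
    (hd : DifferentiableAt ℝ h ρ) (hρ : ρ ∈ posOrth N) (hσ : σ ∈ posOrth N) (hne : σ ≠ ρ)
    (hμ : pgrad h ρ = μ) : (∑ i, μ i * σ i) - h σ < (∑ i, μ i * ρ i) - h ρ := by
  have hlt := hSC.add_fderiv_lt hρ hσ hne.symm hd
  rw [fderiv_apply_eq_sum_pgrad, hμ] at hlt
  simp only [Pi.sub_apply, mul_sub, Finset.sum_sub_distrib] at hlt
  linarith

theorem pgrad_eq_of_isMax {ρ μ : Fin N → ℝ} (hd : DifferentiableAt ℝ h ρ) (hρ : ρ ∈ posOrth N)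
    (hmax : ∀ σ ∈ posOrth N, (∑ i, μ i * σ i) - h σ ≤ (∑ i, μ i * ρ i) - h ρ) :
    pgrad h ρ = μ := by
  have hloc : IsLocalMax (fun σ => dotCLM μ σ - h σ) ρ := by
    filter_upwards [(isOpen_posOrth N).mem_nhds hρ] with σ hσ
    simpa only [dotCLM_apply] using hmax σ hσ
  have h0 := hloc.hasFDerivAt_eq_zero ((dotCLM μ).hasFDerivAt.sub hd.hasFDerivAt)
  refine pgrad_eq_of_hasFDerivAt ?_
  rw [sub_eq_zero.1 h0]
  exact hd.hasFDerivAt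

/-- Arbitrarily close to the origin the objective is almost nonnegative. -/
theorem exists_small_objective (hN : 1 ≤ N)
    (h0 : Tendsto h (𝓟 (posOrth N) ⊓ Filter.comap (rbar (N := N)) (𝓝[>] (0:ℝ))) (𝓝 0))
    (μ : Fin N → ℝ) {R δ : ℝ} (hR : 0 < R) (hδ : 0 < δ) :
    ∃ ρ ∈ posOrth N, (∀ i, ρ i < R) ∧ -δ < (∑ i, μ i * ρ i) - h ρ := by
  have hNpos : (0 : ℝ) < N := by exact_mod_cast hN
  have hray : Tendsto (fun (t : ℝ) (_ : Fin N) => t) (𝓝[>] 0)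
      (𝓟 (posOrth N) ⊓ Filter.comap (rbar (N := N)) (𝓝[>] (0:ℝ))) := by
    refine tendsto_inf.2 ⟨?_, tendsto_comap_iff.2 ?_⟩
    · refine tendsto_principal.2 ?_
      filter_upwards [self_mem_nhdsWithin] with t ht i using ht
    · have : (rbar (N := N)) ∘ (fun (t : ℝ) (_ : Fin N) => t) = fun t => (N : ℝ) * t := by
        ext t; simp [rbar]
      rw [this]
      refine tendsto_nhdsWithin_iff.2 ⟨?_, ?_⟩
      · have : Tendsto (fun t : ℝ => (N : ℝ) * t) (𝓝 0) (𝓝 ((N : ℝ) * 0)) :=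
          (continuous_const.mul continuous_id).tendsto 0
        rw [mul_zero] at this
        exact this.mono_left nhdsWithin_le_nhds
      · filter_upwards [self_mem_nhdsWithin] with t ht using mul_pos hNpos ht
  have hlin : Tendsto (fun t : ℝ => ∑ i, μ i * t) (𝓝[>] 0) (𝓝 0) := by
    have : Tendsto (fun t : ℝ => ∑ i, μ i * t) (𝓝 0) (𝓝 (∑ i, μ i * 0)) :=
      (continuous_finsetSum _ fun i _ => continuous_const.mul continuous_id).tendsto 0
    simp only [mul_zero, Finset.sum_const_zero] at this
    exact this.mono_left nhdsWithin_le_nhds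
  have hlim := hlin.sub (h0.comp hray)
  rw [sub_zero] at hlim
  obtain ⟨t, ht, ht2⟩ :=
    ((hlim.eventually (lt_mem_nhds (neg_lt_zero.2 hδ))).and (Ioo_mem_nhdsGT hR)).exists
  exact ⟨fun _ => t, fun _ => ht2.1, fun _ => ht2.2, ht⟩

/-- Superlinear growth makes the objective negative far from the origin. -/
theorem exists_objective_neg
    (hinf : Tendsto (fun ρ : Fin N → ℝ => h ρ / rbar ρ)
      (𝓟 (posOrth N) ⊓ Filter.comap (rbar (N := N)) atTop) atTop) (μ : Fin N → ℝ) :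
    ∃ R > 0, ∀ ρ ∈ posOrth N, R ≤ rbar ρ → (∑ i, μ i * ρ i) - h ρ < 0 := by
  have hev := hinf.eventually (eventually_gt_atTop ‖μ‖)
  rw [inf_comm, eventually_inf_principal, eventually_comap] at hev
  obtain ⟨R, hR⟩ := eventually_atTop.1 hev
  refine ⟨max R 1, by positivity, fun ρ hρ hle => ?_⟩
  have hpos : 0 < rbar ρ := lt_of_lt_of_le (by positivity) hle
  have hlt := hR (rbar ρ) ((le_max_left _ _).trans hle) ρ rfl hρ
  rw [lt_div_iff₀ hpos] at hlt
  have : ∑ i, μ i * ρ i ≤ ‖μ‖ * rbar ρ := by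
    rw [rbar, Finset.mul_sum]
    exact Finset.sum_le_sum fun i _ => mul_le_mul_of_nonneg_right
      ((le_abs_self _).trans (norm_le_pi_norm μ i)) (hρ i).le
  linarith

/-- The objective defining the conjugate has a maximizer, with nonnegative value. -/
theorem exists_isMax (hN : 1 ≤ N) (hdiff : ∀ ρ ∈ posOrth N, DifferentiableAt ℝ h ρ)
    (hC : ConvexOn ℝ (posOrth N) h) (hH6 : H6a h) (μ : Fin N → ℝ) :
    ∃ ρ ∈ posOrth N, 0 ≤ (∑ i, μ i * ρ i) - h ρ ∧
      ∀ σ ∈ posOrth N, (∑ i, μ i * σ i) - h σ ≤ (∑ i, μ i * ρ i) - h ρ := by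
  obtain ⟨h0, -, hinf, hbd⟩ := hH6
  obtain ⟨R, hRpos, hR⟩ := exists_objective_neg hinf μ
  choose ε hεpos hε using fun i => hbd i (R + 1) (by linarith) (μ i)
  have : Nonempty (Fin N) := ⟨⟨0, hN⟩⟩
  obtain ⟨i₀, hi₀⟩ := Finite.exists_min ε
  obtain ⟨η, hηpos, hη⟩ := exists_between (lt_min (hεpos i₀) hRpos)
  have hηε : ∀ i, η < ε i := fun i => (hη.trans_le (min_le_left _ _)).trans_le (hi₀ i)
  have hηR : η < R := hη.trans_le (min_le_right _ _)
  let K : Set (Fin N → ℝ) := Set.Icc (fun _ => η) (fun _ => R)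
  have hKpos : K ⊆ posOrth N := fun ρ hρ i => hηpos.trans_le (hρ.1 i)
  have hclamp : ∀ ρ ∈ posOrth N, (∀ i, ρ i < R) →
      ∃ σ ∈ K, (∑ i, μ i * ρ i) - h ρ ≤ (∑ i, μ i * σ i) - h σ := by
    intro ρ hρ hρR
    have hσK : (fun i => max (ρ i) η) ∈ K :=
      ⟨fun i => le_max_right _ _, fun i => max_le (hρR i).le hηR.le⟩
    refine ⟨fun i => max (ρ i) η, hσK, ?_⟩
    set σ : Fin N → ℝ := fun i => max (ρ i) η with hσ
    have hle := hC.add_fderiv_le (hKpos hσK) hρ (hdiff σ (hKpos hσK))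
    rw [fderiv_apply_eq_sum_pgrad] at hle
    have hterm : ∑ i, μ i * (ρ - σ) i ≤ ∑ i, pgrad h σ i * (ρ - σ) i := by
      refine Finset.sum_le_sum fun i _ => ?_
      rcases le_total η (ρ i) with hi | hi
      · simp [hσ, max_eq_left hi]
      · have hσi : σ i = η := max_eq_right hi
        have hg := hε i σ (hKpos hσK) (hσi ▸ hηε i)
          fun j _ => (hσK.2 j).trans_lt (lt_add_one R)
        refine mul_le_mul_of_nonpos_right hg.le ?_
        simp [hσi, hi]
    simp only [Pi.sub_apply, mul_sub, Finset.sum_sub_distrib] at hterm hle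
    linarith
  have hcont : ContinuousOn (fun ρ : Fin N → ℝ => (∑ i, μ i * ρ i) - h ρ) K := by
    refine ContinuousOn.sub (by fun_prop) fun ρ hρ => ?_
    exact (hdiff ρ (hKpos hρ)).continuousAt.continuousWithinAt
  obtain ⟨ρ, hρK, hρ⟩ := isCompact_Icc.exists_isMaxOn
    ⟨fun _ => η, le_rfl, fun _ => hηR.le⟩ hcont
  have hnn : 0 ≤ (∑ i, μ i * ρ i) - h ρ := by
    refine le_of_forall_pos_le_add fun δ hδ => ?_
    obtain ⟨τ, hτ, hτR, hτδ⟩ := exists_small_objective hN h0 μ hRpos hδ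
    obtain ⟨σ, hσK, hσ⟩ := hclamp τ hτ hτR
    have := isMaxOn_iff.1 hρ σ hσK
    linarith
  refine ⟨ρ, hKpos hρK, hnn, fun τ hτ => ?_⟩
  by_cases hτR : ∀ i, τ i < R
  · obtain ⟨σ, hσK, hσ⟩ := hclamp τ hτ hτR
    exact hσ.trans (isMaxOn_iff.1 hρ σ hσK)
  · push Not at hτR
    obtain ⟨i, hi⟩ := hτR
    have : τ i ≤ rbar τ := Finset.single_le_sum (fun j _ => (hτ j).le) (Finset.mem_univ i)
    exact (hR τ hτ (hi.trans this)).le.trans hnn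

/-- A right inverse of the gradient of a strictly convex function is continuous. -/
theorem continuous_pgrad_inverse (hdiff : ∀ ρ ∈ posOrth N, DifferentiableAt ℝ h ρ)
    (hSC : StrictConvexOn ℝ (posOrth N) h) {G : (Fin N → ℝ) → Fin N → ℝ}
    (hG : ∀ μ, G μ ∈ posOrth N) (hgrad : ∀ μ, pgrad h (G μ) = μ) : Continuous G := by
  refine continuous_iff_continuousAt.2 fun μ => Metric.continuousAt_iff'.2 fun r₀ hr₀ => ?_
  obtain ⟨r₁, hr₁, hball⟩ := Metric.isOpen_iff.1 (isOpen_posOrth N) (G μ) (hG μ)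
  obtain ⟨r, hr, hrlt⟩ := exists_between (lt_min hr₀ hr₁)
  have hsub : Metric.sphere (G μ) r ⊆ posOrth N := fun σ hσ =>
    hball (lt_of_eq_of_lt hσ (hrlt.trans_le (min_le_right _ _)))
  have hcont : ContinuousOn
      (fun σ => ((∑ i, μ i * G μ i) - h (G μ)) - ((∑ i, μ i * σ i) - h σ))
      (Metric.sphere (G μ) r) := by
    refine continuousOn_const.sub (ContinuousOn.sub (by fun_prop) fun σ hσ => ?_)
    exact (hdiff σ (hsub hσ)).continuousAt.continuousWithinAt
  obtain ⟨c, hc, hcle⟩ := (isCompact_sphere (G μ) r).exists_forall_le' hcont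
    (a := 0) fun σ hσ => sub_pos.2 <| lt_of_pgrad_eq hSC (hdiff _ (hG μ)) (hG μ) (hsub hσ)
      (Metric.ne_of_mem_sphere hσ hr.ne') (hgrad μ)
  have hsmall : ∀ᶠ ν in 𝓝 μ, (N : ℝ) * (‖ν - μ‖ * r) < c := by
    have ht : Tendsto (fun ν : Fin N → ℝ => (N : ℝ) * (‖ν - μ‖ * r)) (𝓝 μ)
        (𝓝 ((N : ℝ) * (‖μ - μ‖ * r))) := Continuous.tendsto (by fun_prop) μ
    rw [sub_self, norm_zero, zero_mul, mul_zero] at ht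
    exact ht.eventually (gt_mem_nhds hc)
  filter_upwards [hsmall] with ν hν
  refine lt_of_le_of_lt ?_ (hrlt.trans_le (min_le_left _ _))
  by_contra! hfar
  rw [dist_eq_norm] at hfar
  have hdpos : 0 < ‖G ν - G μ‖ := hr.trans hfar
  set t : ℝ := r / ‖G ν - G μ‖ with ht
  have ht0 : 0 < t := div_pos hr hdpos
  have ht1 : t < 1 := (div_lt_one hdpos).2 hfar
  set σ : Fin N → ℝ := (1 - t) • G μ + t • G ν with hσ
  have hσsub : σ - G μ = t • (G ν - G μ) := by rw [hσ]; module
  have hnorm : ‖σ - G μ‖ = r := by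
    rw [hσsub, norm_smul, Real.norm_of_nonneg ht0.le, ht, div_mul_cancel₀ _ hdpos.ne']
  have hσsph : σ ∈ Metric.sphere (G μ) r := by rw [mem_sphere_iff_norm, hnorm]
  have hconv := hSC.convexOn.2 (hG μ) (hG ν) (sub_nonneg.2 ht1.le) ht0.le (by ring)
  rw [← hσ] at hconv
  simp only [smul_eq_mul] at hconv
  have hlin : ∑ i, ν i * σ i = (1 - t) * ∑ i, ν i * G μ i + t * ∑ i, ν i * G ν i := by
    rw [Finset.mul_sum, Finset.mul_sum, ← Finset.sum_add_distrib]
    refine Finset.sum_congr rfl fun i _ => ?_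
    simp only [hσ, Pi.add_apply, Pi.smul_apply, smul_eq_mul]
    ring
  have hmax := lt_of_pgrad_eq hSC (hdiff _ (hG ν)) (hG ν) (hG μ)
    (by rintro he; rw [he, sub_self, norm_zero] at hdpos; exact hdpos.false) (hgrad ν)
  have hmaxt := mul_le_mul_of_nonneg_left hmax.le ht0.le
  have hsep := hcle σ hσsph
  have hpert := (le_abs_self _).trans (abs_sum_mul_le (ν - μ) (σ - G μ))
  rw [hnorm] at hpert
  simp only [Pi.sub_apply, mul_sub, sub_mul, Finset.sum_sub_distrib] at hpert
  linarith

/-- If `G` is a continuous selection of subgradients of `F`,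
then `G` is the gradient of `F`. -/
theorem hasFDerivAt_of_subgradient {F : (Fin N → ℝ) → ℝ} {G : (Fin N → ℝ) → Fin N → ℝ}
    (hGc : Continuous G) (hsub : ∀ μ ν, F μ + ∑ i, G μ i * (ν - μ) i ≤ F ν) (μ : Fin N → ℝ) :
    HasFDerivAt F (dotCLM (G μ)) μ := by
  rw [hasFDerivAt_iff_isLittleO, Asymptotics.isLittleO_iff]
  intro c hc
  have hsmall : ∀ᶠ ν in 𝓝 μ, (N : ℝ) * ‖G ν - G μ‖ < c := by
    have ht : Tendsto (fun ν => (N : ℝ) * ‖G ν - G μ‖) (𝓝 μ) (𝓝 ((N : ℝ) * ‖G μ - G μ‖)) :=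
      Continuous.tendsto (by fun_prop) μ
    rw [sub_self, norm_zero, mul_zero] at ht
    exact ht.eventually (gt_mem_nhds hc)
  filter_upwards [hsmall] with ν hν
  have hlow := hsub μ ν
  have hup := hsub ν μ
  have hpert := (le_abs_self _).trans (abs_sum_mul_le (G ν - G μ) (ν - μ))
  rw [← mul_assoc] at hpert
  have hb := mul_le_mul_of_nonneg_right hν.le (norm_nonneg (ν - μ))
  rw [dotCLM_apply, Real.norm_of_nonneg (by linarith)]
  simp only [Pi.sub_apply, mul_sub, sub_mul, Finset.sum_sub_distrib] at *
  linarith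

end Conjugate

/-- Under (H6a), for every `μ` the supremum defining `h*(μ)` is
finite, nonnegative and attained at a unique point of the positive orthant, which is
characterized by `μ = ∇h(ρ)`; consequently `∇h` is a bijection from `(0,∞)^N` onto
`ℝ^N`, `h*` is differentiable everywhere, and `∇h* = (∇h)⁻¹` maps `ℝ^N` onto
`(0,∞)^N`. -/
theorem stmt0 (N : ℕ) (hN : 1 ≤ N) (θ : ℝ) (hθ : 0 < θ)
    (h : (Fin N → ℝ) → ℝ)
    (hC2 : ContDiffOn ℝ 2 h (posOrth N))
    (hSC : StrictConvexOn ℝ (posOrth N) h)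
    (hH6 : H6a h) :
    (∀ μ : Fin N → ℝ,
      BddAbove ((fun ρ => (∑ i, μ i * ρ i) - h ρ) '' posOrth N) ∧
      0 ≤ hstar h μ ∧
      (∃! ρ, ρ ∈ posOrth N ∧ (∑ i, μ i * ρ i) - h ρ = hstar h μ) ∧
      (∀ ρ ∈ posOrth N, ((∑ i, μ i * ρ i) - h ρ = hstar h μ ↔ pgrad h ρ = μ))) ∧
    Set.BijOn (pgrad h) (posOrth N) Set.univ ∧
    Differentiable ℝ (hstar h) ∧
    (∀ μ : Fin N → ℝ, pgrad (hstar h) μ ∈ posOrth N ∧ pgrad h (pgrad (hstar h) μ) = μ) ∧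
    (∀ ρ ∈ posOrth N, pgrad (hstar h) (pgrad h ρ) = ρ) ∧
    Set.SurjOn (pgrad (hstar h)) Set.univ (posOrth N) := by
  have hdiff : ∀ ρ ∈ posOrth N, DifferentiableAt ℝ h ρ := fun ρ hρ =>
    (hC2.differentiableOn (by norm_num)).differentiableAt ((isOpen_posOrth N).mem_nhds hρ)
  choose G hG hnn hmax using exists_isMax hN hdiff hSC.convexOn hH6
  have hgrad : ∀ μ, pgrad h (G μ) = μ := fun μ => pgrad_eq_of_isMax (hdiff _ (hG μ)) (hG μ) (hmax μ)
  have hgreatest : ∀ μ, IsGreatest ((fun ρ => (∑ i, μ i * ρ i) - h ρ) '' posOrth N)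
      ((∑ i, μ i * G μ i) - h (G μ)) := fun μ =>
    ⟨⟨G μ, hG μ, rfl⟩, by rintro _ ⟨σ, hσ, rfl⟩; exact hmax μ σ hσ⟩
  have hval : ∀ μ, hstar h μ = (∑ i, μ i * G μ i) - h (G μ) := fun μ => (hgreatest μ).csSup_eq
  have huniq : ∀ μ, ∀ ρ ∈ posOrth N, (∑ i, μ i * ρ i) - h ρ = hstar h μ → ρ = G μ := by
    intro μ ρ hρ he
    by_contra hne
    have := lt_of_pgrad_eq hSC (hdiff _ (hG μ)) (hG μ) hρ hne (hgrad μ)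
    rw [he, hval μ] at this
    exact this.false
  have hinv : ∀ ρ ∈ posOrth N, G (pgrad h ρ) = ρ := by
    intro ρ hρ
    by_contra hne
    exact (lt_of_pgrad_eq hSC (hdiff ρ hρ) hρ (hG _) hne rfl).not_ge (hmax (pgrad h ρ) ρ hρ)
  have hderiv : ∀ μ, HasFDerivAt (hstar h) (dotCLM (G μ)) μ := by
    refine hasFDerivAt_of_subgradient (continuous_pgrad_inverse hdiff hSC hG hgrad) fun μ ν => ?_
    have hle := hmax ν (G μ) (hG μ)
    rw [hval μ, hval ν]
    simp only [Pi.sub_apply, mul_comm (G μ _), sub_mul, Finset.sum_sub_distrib]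
    linarith
  have hpg : ∀ μ, pgrad (hstar h) μ = G μ := fun μ => pgrad_eq_of_hasFDerivAt (hderiv μ)
  refine ⟨fun μ => ⟨(hgreatest μ).bddAbove, hval μ ▸ hnn μ,
    ⟨G μ, ⟨hG μ, (hval μ).symm⟩, fun ρ hρ => huniq μ ρ hρ.1 hρ.2⟩, fun ρ hρ => ⟨fun he => ?_, ?_⟩⟩,
    ⟨fun _ _ => Set.mem_univ _, fun ρ hρ σ hσ he => ?_, fun μ _ => ⟨G μ, hG μ, hgrad μ⟩⟩,
    fun μ => (hderiv μ).differentiableAt, fun μ => ?_, fun ρ hρ => ?_, fun ρ hρ => ?_⟩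
  · rw [huniq μ ρ hρ he, hgrad]
  · rintro rfl
    rw [hval, hinv ρ hρ]
  · rw [← hinv ρ hρ, he, hinv σ hσ]
  · rw [hpg]
    exact ⟨hG μ, hgrad μ⟩
  · rw [hpg, hinv ρ hρ]
  · exact ⟨pgrad h ρ, Set.mem_univ _, by rw [hpg, hinv ρ hρ]⟩
end
end

section
/- Let f : (0,∞) → ℝ be continuous with compact support contained in (0,∞), and define b_f(s) = −s ∫_s^∞ f(t) t^{-2} dt for s > 0, extended by b_f(0) = 0. Then b_f is C¹ on (0,∞), bounded, b_f(s) = 0 for all s ≥ sup(supp f) (so b_f' has bounded support), b_f is linear near 0, and s·b_f'(s) − b_f(s) = f(s) for all s > 0. -/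
open Filter Topology MeasureTheory

noncomputable section

/-- The renormalization function `b_f(s) = −s ∫_s^∞ f(t) t⁻² dt`. -/
def bfun (f : ℝ → ℝ) (s : ℝ) : ℝ := -s * ∫ t in Set.Ioi s, f t / t ^ 2

/-- The integrand `f t / t ^ 2` is continuous when `f` is supported away from `0`. -/
lemma continuous_div_sq_of_tsupport_subset {f : ℝ → ℝ} (hf : Continuous f)
    (hfs : tsupport f ⊆ Set.Ioi 0) : Continuous fun t => f t / t ^ 2 := by
  rw [continuous_iff_continuousAt]
  intro t
  by_cases ht : t ∈ tsupport f
  · exact hf.continuousAt.div (by fun_prop) (pow_ne_zero 2 (hfs ht).ne')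
  · have h : (fun t => f t / t ^ 2) =ᶠ[𝓝 t] fun _ => 0 := by
      filter_upwards [notMem_tsupport_iff_eventuallyEq.mp ht] with x hx
      simp [hx]
    exact continuousAt_const.congr h.symm

/-- A tail integral as a constant minus an interval integral. -/
lemma integral_Ioi_eq_sub_intervalIntegral {g : ℝ → ℝ} (hg : Integrable g) (a s : ℝ) :
    ∫ t in Set.Ioi s, g t = (∫ t in Set.Ioi a, g t) - ∫ t in a..s, g t := by
  rw [← intervalIntegral.integral_Ioi_sub_Ioi' hg.integrableOn hg.integrableOn]
  ring

/-- The derivative of a tail integral of a continuous integrable function. -/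
lemma hasDerivAt_integral_Ioi {g : ℝ → ℝ} (hg : Continuous g) (hgi : Integrable g) (s : ℝ) :
    HasDerivAt (fun s => ∫ t in Set.Ioi s, g t) (-g s) s := by
  rw [funext (integral_Ioi_eq_sub_intervalIntegral hgi 0)]
  exact (hg.integral_hasStrictDerivAt 0 s).hasDerivAt.const_sub _

/-- For `f : (0,∞) → ℝ` continuous with compact support contained
in `(0,∞)`, the function `b_f(s) = −s∫_s^∞ f(t)t⁻² dt` (with `b_f(0) = 0`) is C¹ on
`(0,∞)`, bounded on `[0,∞)`, vanishes for `s ≥ sup(supp f)`, is linear near `0`, and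
satisfies `s·b_f'(s) − b_f(s) = f(s)` for all `s > 0`. -/
theorem stmt13 (f : ℝ → ℝ) (hf : Continuous f) (hfc : HasCompactSupport f)
    (hfs : tsupport f ⊆ Set.Ioi 0) :
    ContDiffOn ℝ 1 (bfun f) (Set.Ioi 0) ∧
    bfun f 0 = 0 ∧
    (∃ M : ℝ, ∀ s ≥ (0:ℝ), |bfun f s| ≤ M) ∧
    (∀ s : ℝ, (∀ t ∈ tsupport f, t ≤ s) → bfun f s = 0) ∧
    (∃ ε > (0:ℝ), ∃ a : ℝ, ∀ s ∈ Set.Ico (0:ℝ) ε, bfun f s = a * s) ∧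
    (∀ s > (0:ℝ), s * deriv (bfun f) s - bfun f s = f s) := by
  have hg := continuous_div_sq_of_tsupport_subset hf hfs
  have hgc : HasCompactSupport fun t => f t / t ^ 2 :=
    hfc.mono fun t ht h => ht (by simp [h])
  have hgi : Integrable fun t => f t / t ^ 2 := hg.integrable_of_hasCompactSupport hgc
  have hG := hasDerivAt_integral_Ioi hg hgi
  have hb (s : ℝ) : HasDerivAt (bfun f)
      (-1 * (∫ t in Set.Ioi s, f t / t ^ 2) + -s * -(f s / s ^ 2)) s :=
    (hasDerivAt_id s).neg.mul (hG s)
  have hbd : deriv (bfun f) =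
      fun s => -1 * (∫ t in Set.Ioi s, f t / t ^ 2) + -s * -(f s / s ^ 2) :=
    funext fun s => (hb s).deriv
  have hbc : Continuous (bfun f) :=
    continuous_iff_continuousAt.mpr fun s => (hb s).continuousAt
  have hGc : Continuous fun s => ∫ t in Set.Ioi s, f t / t ^ 2 :=
    continuous_iff_continuousAt.mpr fun s => (hG s).continuousAt
  have hvanish (s : ℝ) (hs : ∀ t ∈ tsupport f, t ≤ s) : bfun f s = 0 := by
    have h : ∫ t in Set.Ioi s, f t / t ^ 2 = 0 := by
      refine setIntegral_eq_zero_of_forall_eq_zero fun t ht => ?_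
      rw [image_eq_zero_of_notMem_tsupport fun h => (hs t h).not_gt ht, zero_div]
    simp [bfun, h]
  refine ⟨?_, by simp [bfun], ?_, hvanish, ?_, ?_⟩
  · refine (contDiff_one_iff_deriv.mpr ⟨fun s => (hb s).differentiableAt, ?_⟩).contDiffOn
    rw [hbd]
    fun_prop
  · obtain ⟨R, hR⟩ := hfc.isCompact.bddAbove
    obtain ⟨C, hC⟩ := (isCompact_Icc (a := (0 : ℝ)) (b := R)).exists_bound_of_continuousOn
      hbc.continuousOn
    refine ⟨max C 0, fun s hs => ?_⟩
    rcases le_total s R with h | h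
    · exact le_max_of_le_left (hC s ⟨hs, h⟩)
    · simp [hvanish s fun t ht => (hR ht).trans h]
  · have h0 : (0 : ℝ) ∉ tsupport f := fun h => (Set.mem_Ioi.mp (hfs h)).false
    obtain ⟨ε, hε, h⟩ := Metric.eventually_nhds_iff.mp (notMem_tsupport_iff_eventuallyEq.mp h0)
    refine ⟨ε, hε, -∫ t in Set.Ioi 0, f t / t ^ 2, fun s hs => ?_⟩
    have hz : ∫ t in (0 : ℝ)..s, f t / t ^ 2 = 0 := by
      refine intervalIntegral.integral_zero_ae (Eventually.of_forall fun t ht => ?_)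
      rw [Set.uIoc_of_le hs.1] at ht
      have hft : f t = 0 := h (by
        rw [Real.dist_eq, sub_zero, abs_of_pos ht.1]
        exact ht.2.trans_lt hs.2)
      rw [hft, zero_div]
    rw [bfun, integral_Ioi_eq_sub_intervalIntegral hgi 0 s, hz]
    ring
  · intro s hs
    rw [hbd, bfun]
    field_simp
    ring
end
end

section
/- Let (Ω, μ) be a finite measure space, let ρ : Ω → [0,∞) be measurable with ρ ∈ L¹(Ω), and let g ∈ L¹(Ω). Suppose that for every b ∈ C¹([0,∞)) with b(0) = 0 and with b' of bounded support (b'(s) = 0 for all s ≥ S for some S > 0), one has ∫_Ω (ρ b'(ρ) − b(ρ)) g dμ = 0. Then for every k ∈ ℕ and every truncation T_k as defined below, ∫_Ω T_k(ρ) g dμ = 0. -/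
open Filter Topology MeasureTheory

noncomputable section

/-- For continuous `h`, the function `b s = s * ∫ t in R..s, h t` is `C¹` with
`s * b' s - b s = s ^ 2 * h s`. -/
lemma hasDerivAt_mul_integral {h : ℝ → ℝ} (hc : Continuous h) (R s : ℝ) :
    HasDerivAt (fun s => s * ∫ t in R..s, h t) ((∫ t in R..s, h t) + s * h s) s := by
  have h1 : HasDerivAt (fun s => ∫ t in R..s, h t) (h s) s :=
    intervalIntegral.integral_hasDerivAt_right (hc.intervalIntegrable _ _)
      (hc.stronglyMeasurableAtFilter _ _) hc.continuousAt
  simpa using (hasDerivAt_id' s).fun_mul h1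

lemma contDiff_mul_integral {h : ℝ → ℝ} (hc : Continuous h) (R : ℝ) :
    ContDiff ℝ 1 (fun s => s * ∫ t in R..s, h t) := by
  rw [contDiff_one_iff_deriv]
  refine ⟨fun s => (hasDerivAt_mul_integral hc R s).differentiableAt, ?_⟩
  rw [funext fun s => (hasDerivAt_mul_integral hc R s).deriv]
  exact (intervalIntegral.continuous_primitive (fun _ _ => hc.intervalIntegrable _ _) R).add
    (continuous_id.mul hc)

lemma integral_sq_mul_eq_zero {Ω : Type*} [MeasurableSpace Ω] {μ : Measure Ω} {ρ g : Ω → ℝ}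
    (hyp : ∀ b : ℝ → ℝ, ContDiffOn ℝ 1 b (Set.Ici 0) → b 0 = 0 →
      (∃ S > (0:ℝ), ∀ s ≥ S, deriv b s = 0) →
      ∫ x, (ρ x * deriv b (ρ x) - b (ρ x)) * g x ∂μ = 0)
    {h : ℝ → ℝ} (hc : Continuous h) {R : ℝ} (hR : 0 < R) (hz : ∀ t ≥ R, h t = 0) :
    ∫ x, ρ x ^ 2 * h (ρ x) * g x ∂μ = 0 := by
  rw [← hyp _ (contDiff_mul_integral hc R).contDiffOn (by simp) ⟨R, hR, fun s hs => ?_⟩]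
  · refine integral_congr_ae (.of_forall fun x => ?_)
    simp only [(hasDerivAt_mul_integral hc R _).deriv]
    ring
  · have h0 : ∫ t in R..s, h t = 0 := by
      rw [intervalIntegral.integral_congr (g := fun _ => (0 : ℝ)), intervalIntegral.integral_zero]
      intro t ht
      rw [Set.uIcc_of_le hs] at ht
      exact hz t ht.1
    rw [(hasDerivAt_mul_integral hc R s).deriv, h0, hz s hs]
    simp

/-- The cutoff in the variable `t`, vanishing at `0` and for `t ≥ n + 1`, is `t ^ 2` times this
continuous function. -/
def cutoffDivSq (n : ℕ) (t : ℝ) : ℝ :=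
  max 0 (min 1 (n + 1 - t)) / (t ^ 2 + 1 / ((n : ℝ) + 1))

lemma sq_add_one_div_pos (n : ℕ) (t : ℝ) : 0 < t ^ 2 + 1 / ((n : ℝ) + 1) := by positivity

lemma continuous_cutoffDivSq (n : ℕ) : Continuous (cutoffDivSq n) := by
  unfold cutoffDivSq
  exact Continuous.div (by fun_prop) (by fun_prop) fun t => (sq_add_one_div_pos n t).ne'

lemma cutoffDivSq_eq_zero {n : ℕ} {t : ℝ} (ht : (n : ℝ) + 1 ≤ t) : cutoffDivSq n t = 0 := by
  have : min 1 ((n : ℝ) + 1 - t) ≤ 0 := (min_le_right _ _).trans (by linarith)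
  simp [cutoffDivSq, max_eq_left this]

lemma abs_sq_mul_cutoffDivSq_le (n : ℕ) (t : ℝ) : |t ^ 2 * cutoffDivSq n t| ≤ 1 := by
  have hp := sq_add_one_div_pos n t
  have h0 : 0 ≤ max 0 (min 1 ((n : ℝ) + 1 - t)) := le_max_left _ _
  have h1 : max 0 (min 1 ((n : ℝ) + 1 - t)) ≤ 1 := max_le zero_le_one (min_le_left _ _)
  have h2 : 0 < 1 / ((n : ℝ) + 1) := by positivity
  rw [cutoffDivSq, ← mul_div_assoc, abs_of_nonneg (by positivity), div_le_one hp]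
  nlinarith [sq_nonneg t]

lemma tendsto_sq_mul_cutoffDivSq {t : ℝ} (ht : t ≠ 0) :
    Tendsto (fun n => t ^ 2 * cutoffDivSq n t) atTop (𝓝 1) := by
  have ht2 : t ^ 2 + 0 ≠ 0 := by simpa using ht
  have h1 : Tendsto (fun n : ℕ => t ^ 2 / (t ^ 2 + 1 / ((n : ℝ) + 1))) atTop (𝓝 1) := by
    have := (tendsto_const_nhds (x := t ^ 2)).div
      ((tendsto_const_nhds (x := t ^ 2)).add
        (tendsto_one_div_add_atTop_nhds_zero_nat (𝕜 := ℝ))) ht2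
    rwa [add_zero, div_self (by simpa using ht2)] at this
  refine h1.congr' ?_
  filter_upwards [eventually_ge_atTop ⌈t⌉₊] with n hn
  have hn' : t ≤ n := Nat.ceil_le.mp hn
  rw [cutoffDivSq, min_eq_left (by linarith), max_eq_right zero_le_one, mul_one_div]

lemma integral_comp_mul_eq_zero {Ω : Type*} [MeasurableSpace Ω] {μ : Measure Ω} {ρ g : Ω → ℝ}
    (hρ : Measurable ρ) (hg : Integrable g μ)
    (hyp : ∀ b : ℝ → ℝ, ContDiffOn ℝ 1 b (Set.Ici 0) → b 0 = 0 →
      (∃ S > (0:ℝ), ∀ s ≥ S, deriv b s = 0) →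
      ∫ x, (ρ x * deriv b (ρ x) - b (ρ x)) * g x ∂μ = 0)
    {F : ℝ → ℝ} (hF : Continuous F) (hF0 : F 0 = 0) {C : ℝ} (hC : ∀ t, |F t| ≤ C) :
    ∫ x, F (ρ x) * g x ∂μ = 0 := by
  have hzero (n : ℕ) : ∫ x, ρ x ^ 2 * (F (ρ x) * cutoffDivSq n (ρ x)) * g x ∂μ = 0 :=
    integral_sq_mul_eq_zero hyp (h := fun t => F t * cutoffDivSq n t)
      (hF.mul (continuous_cutoffDivSq n)) (R := n + 1) (by positivity)
      fun t ht => by rw [cutoffDivSq_eq_zero ht, mul_zero]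
  have hlim : Tendsto (fun n : ℕ => ∫ x, ρ x ^ 2 * (F (ρ x) * cutoffDivSq n (ρ x)) * g x ∂μ)
      atTop (𝓝 (∫ x, F (ρ x) * g x ∂μ)) := by
    refine tendsto_integral_of_dominated_convergence (fun x => C * |g x|) (fun n => ?_)
      (hg.abs.const_mul C) (fun n => .of_forall fun x => ?_) (.of_forall fun x => ?_)
    · have := (continuous_cutoffDivSq n).measurable
      have := hF.measurable
      exact (Measurable.aestronglyMeasurable (by fun_prop)).mul hg.1
    · rw [Real.norm_eq_abs, abs_mul, mul_left_comm, abs_mul]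
      refine mul_le_mul_of_nonneg_right ?_ (abs_nonneg _)
      exact (mul_le_of_le_one_right (abs_nonneg _) (abs_sq_mul_cutoffDivSq_le n _)).trans (hC _)
    · by_cases hx : ρ x = 0
      · simp [hx, hF0]
      · simpa [mul_left_comm] using
          ((tendsto_sq_mul_cutoffDivSq hx).const_mul (F (ρ x))).mul_const (g x)
  exact tendsto_nhds_unique hlim (by simp only [hzero, tendsto_const_nhds])

/-- On a finite measure space, if
`∫ (ρ b'(ρ) − b(ρ)) g dμ = 0` for every `b ∈ C¹([0,∞))` with `b(0) = 0` and `b'` of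
bounded support, then `∫ T_k(ρ) g dμ = 0` for every `k ≥ 1` and every truncation
`T_k(z) = k T₁(z/k)`, where `T₁` is C¹ on `[0,∞)`, concave and nondecreasing there,
with `T₁(z) = z` on `[0,1]` and `T₁(z) = 2` for `z ≥ 3`. -/
theorem stmt14 {Ω : Type*} [MeasurableSpace Ω] (μ : Measure Ω) [IsFiniteMeasure μ]
    (ρ : Ω → ℝ) (hρm : Measurable ρ) (hρ0 : ∀ x, 0 ≤ ρ x) (hρ1 : Integrable ρ μ)
    (g : Ω → ℝ) (hg : Integrable g μ)
    (hyp : ∀ b : ℝ → ℝ, ContDiffOn ℝ 1 b (Set.Ici 0) → b 0 = 0 →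
      (∃ S > (0:ℝ), ∀ s ≥ S, deriv b s = 0) →
      ∫ x, (ρ x * deriv b (ρ x) - b (ρ x)) * g x ∂μ = 0)
    (T1 : ℝ → ℝ) (hT1C1 : ContDiffOn ℝ 1 T1 (Set.Ici 0))
    (hT1conc : ConcaveOn ℝ (Set.Ici 0) T1)
    (hT1mono : MonotoneOn T1 (Set.Ici 0))
    (hT1id : ∀ z ∈ Set.Icc (0:ℝ) 1, T1 z = z)
    (hT1const : ∀ z ≥ (3:ℝ), T1 z = 2) :
    ∀ k : ℕ, 0 < k → ∫ x, (k : ℝ) * T1 (ρ x / k) * g x ∂μ = 0 := by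
  intro k hk
  have hk' : (0 : ℝ) < k := Nat.cast_pos.mpr hk
  have hpos (t : ℝ) : max t 0 / k ∈ Set.Ici (0 : ℝ) := div_nonneg (le_max_right _ _) hk'.le
  have h00 : T1 0 = 0 := hT1id 0 (by simp)
  have hF : Continuous fun t => (k : ℝ) * T1 (max t 0 / k) :=
    continuous_const.mul (hT1C1.continuousOn.comp_continuous (by fun_prop) hpos)
  have hbound (z : ℝ) (hz : z ∈ Set.Ici (0 : ℝ)) : |T1 z| ≤ 2 := by
    have h1 : T1 0 ≤ T1 z := hT1mono (by simp) hz hz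
    have h2 : T1 z ≤ T1 (max z 3) :=
      hT1mono hz (Set.mem_Ici.mpr (le_max_of_le_left hz)) (le_max_left _ _)
    rw [hT1const _ (le_max_right _ _)] at h2
    rw [abs_of_nonneg (h00 ▸ h1)]
    exact h2
  have := integral_comp_mul_eq_zero hρm hg hyp hF (by simp [h00]) (C := k * 2) fun t => by
    rw [abs_mul, abs_of_pos hk']
    exact mul_le_mul_of_nonneg_left (hbound _ (hpos t)) hk'.le
  simpa only [max_eq_left (hρ0 _)] using this
end
end
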